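/- arXiv:2501.13021 — 5 statements merged into one kernel-verified Lean document; each statement's English description precedes it below -/
import Mathlib

section
/- For transmission of a binary linear code over a binary memoryless symmetric channel, the maximum-likelihood decoding error probability satisfies P_e ≤ Σ_{ℓ} (∏_{j=−M}^{M} ε_{j|0}^{ℓ_j}) · min{ Σ_{w=d_min}^{n} S_w Σ_{μ} (w choose μ_{−M},…,μ_M)(n−w choose ℓ_{−M}−μ_{−M},…,ℓ_M−μ_M), (n choose ℓ_{−M},…,ℓ_M) }, where the outer sum ranges over all vectors ℓ = (ℓ_{−M},…,ℓ_M) of nonnegative integers with Σ_j ℓ_j = n, and the inner sum over μ ranges over all vectors μ = (μ_{−M},…,μ_M) of nonnegative integers with Σ_j μ_j = w, μ_j ≤ ℓ_j for every j, and satisfying the pairwise-error condition ∏_{j=−M}^{M} ε_{j|0}^{μ_j} ≤ ∏_{j=−M}^{M} ε_{j|1}^{μ_j}. -/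
/-!
Extension of the Poltyrev bound to binary memoryless symmetric (BMS) channels
with discrete output alphabet 𝒴 = {-M, …, M} (Theorem 1 of the paper).
-/

open Finset

open scoped Classical

noncomputable section

/-- The output alphabet `𝒴 = {-M, …, -1, 0, 1, …, M}` of a BMS channel. -/
abbrev outAlphabet (M : ℕ) : Type := ↥(Finset.Icc (-(M : ℤ)) (M : ℤ))

/-- The number of words of a given type is a multinomial coefficient. -/
theorem card_filter_type_eq_multinomial {ι α : Type*} [Fintype ι] [Fintype α] [DecidableEq α]
    (f : α → ℕ) (hf : ∑ j, f j = Fintype.card ι) :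
    #{y : ι → α | ∀ j, #{i | y i = j} = f j} = Nat.multinomial univ f := by
  have key : (∑ j : α, (MvPolynomial.X j : MvPolynomial α ℕ)) ^ Fintype.card ι =
      ∑ y : ι → α, ∏ i, (MvPolynomial.X (y i) : MvPolynomial α ℕ) := by
    rw [← Fintype.piFinset_univ, ← Finset.prod_univ_sum]
    simp
  have hmon (k : α → ℕ) : ∏ j, (MvPolynomial.X j : MvPolynomial α ℕ) ^ k j =
      MvPolynomial.monomial (Finsupp.equivFunOnFinite.symm k) 1 := by
    rw [MvPolynomial.monomial_eq, Finsupp.prod_fintype _ _ (by simp)]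
    simp
  have hword (y : ι → α) : ∏ i, (MvPolynomial.X (y i) : MvPolynomial α ℕ) =
      MvPolynomial.monomial (Finsupp.equivFunOnFinite.symm fun j => #{i | y i = j}) 1 := by
    rw [← hmon, ← Finset.prod_fiberwise' univ y]
    simp
  rw [Finset.sum_pow_eq_sum_piAntidiag] at key
  have := congrArg (MvPolynomial.coeff (Finsupp.equivFunOnFinite.symm f)) key
  simp only [MvPolynomial.coeff_sum, hword, hmon, MvPolynomial.coeff_monomial,
    EmbeddingLike.apply_eq_iff_eq, ← map_natCast (MvPolynomial.C (σ := α) (R := ℕ)),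
    MvPolynomial.coeff_C_mul] at this
  rw [Finset.card_filter]
  simp only [funext_iff] at this
  rw [← this, Finset.sum_eq_single f]
  · simp
  · intro k _ hk
    rw [if_neg (by simpa [funext_iff] using hk)]
    simp
  · intro h
    exact absurd (by simpa [Finset.mem_piAntidiag] using hf) h

theorem card_filter_subtype {ι : Type*} [Fintype ι] (p q : ι → Prop)
    [DecidablePred p] [DecidablePred q] :
    #{i : {i // p i} | q i} = #{i | p i ∧ q i} := by
  rw [← Finset.filter_filter, Finset.card_filter, Finset.card_filter,
    Finset.sum_subtype _ (p := p) (by simp)]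

/-- The words of type `l` whose restriction to `p` has type `m` are at most as many as the pairs
consisting of a word of type `m` on `p` and a word of type `l - m` on the complement. -/
theorem card_filter_joint_type_le {ι α : Type*} [Fintype ι] [Fintype α] [DecidableEq α]
    (p : ι → Prop) [DecidablePred p] (l m : α → ℕ) (hl : ∑ j, l j = Fintype.card ι)
    (hm : ∑ j, m j = #{i | p i}) (hml : ∀ j, m j ≤ l j) :
    #{y : ι → α | (∀ j, #{i | y i = j} = l j) ∧ ∀ j, #{i | p i ∧ y i = j} = m j} ≤
      Nat.multinomial univ m * Nat.multinomial univ (fun j => l j - m j) := by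
  have hc : ∑ j, (l j - m j) = Fintype.card {i // ¬ p i} := by
    rw [Finset.sum_tsub_distrib _ fun j _ => hml j, hl, hm, Fintype.card_subtype_compl,
      Fintype.card_subtype]
  rw [← card_filter_type_eq_multinomial (ι := {i // p i}) m (by rw [hm, Fintype.card_subtype]),
    ← card_filter_type_eq_multinomial (ι := {i // ¬ p i}) _ hc, ← Finset.card_product]
  refine Finset.card_le_card_of_injOn (fun y => (fun i => y i, fun i => y i)) ?_ ?_
  · intro y hy
    simp only [Finset.coe_filter, Finset.mem_univ, true_and, Set.mem_ofPred_eq] at hy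
    simp only [Finset.coe_product, Set.mem_prod, Finset.coe_filter, Finset.mem_univ, true_and,
      Set.mem_ofPred_eq]
    refine ⟨fun j => ?_, fun j => ?_⟩
    · rw [card_filter_subtype p (fun i => y i = j), hy.2]
    · rw [card_filter_subtype (fun i => ¬ p i) (fun i => y i = j), ← hy.1, ← hy.2]
      have := Finset.card_filter_add_card_filter_not (s := ({i | y i = j} : Finset ι)) p
      simp only [Finset.filter_filter] at this
      simp only [and_comm (b := y _ = j)]
      omega
  · intro y _ z _ h
    simp only [Prod.mk.injEq, funext_iff, Subtype.forall] at h
    funext i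
    by_cases hi : p i
    · exact h.1 i hi
    · exact h.2 i hi

theorem prod_pow_card_filter {ι α : Type*} [Fintype ι] [Fintype α] [DecidableEq α]
    (p : ι → Prop) [DecidablePred p]
    (y : ι → α) (g : α → ℝ) :
    ∏ j, g j ^ #{i | p i ∧ y i = j} = ∏ i with p i, g (y i) := by
  rw [← Finset.prod_fiberwise' _ y]
  simp [Finset.filter_filter]

/-- If a received word has positive likelihood, a codeword at least as likely as zero is at
least as likely on its own support. -/
theorem prod_support_le_of_prod_le {ι α : Type*} [Fintype ι] (g : α → Bool → ℝ)
    (hg : ∀ a b, 0 ≤ g a b) (c : ι → Bool) (y : ι → α) (hpos : ∏ i, g (y i) false ≠ 0)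
    (h : ∏ i, g (y i) false ≤ ∏ i, g (y i) (c i)) :
    ∏ i with c i = true, g (y i) false ≤ ∏ i with c i = true, g (y i) true := by
  have hoff : 0 < ∏ i with ¬ c i = true, g (y i) false :=
    Finset.prod_pos fun i _ =>
      (hg _ _).lt_of_ne' (Finset.prod_ne_zero_iff.1 hpos i (Finset.mem_univ i))
  rw [← Finset.prod_filter_mul_prod_filter_not univ (fun i => c i = true),
    ← Finset.prod_filter_mul_prod_filter_not univ (fun i => c i = true)
      (fun i => g (y i) (c i))] at h
  have h1 : ∏ i with c i = true, g (y i) (c i) = ∏ i with c i = true, g (y i) true :=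
    Finset.prod_congr rfl fun i hi => by rw [(Finset.mem_filter.1 hi).2]
  have h2 : ∏ i with ¬ c i = true, g (y i) (c i) = ∏ i with ¬ c i = true, g (y i) false :=
    Finset.prod_congr rfl fun i hi => by
      rw [Bool.eq_false_iff.2 (Finset.mem_filter.1 hi).2]
  rw [h1, h2] at h
  exact le_of_mul_le_mul_right h hoff

/-- Number of words of type `l` for which the word `c` of weight `w` beats the zero word. -/
theorem card_pairwise_error_le {α : Type*} [Fintype α] [DecidableEq α] {n : ℕ} (g : α → Bool → ℝ)
    (hg : ∀ a b, 0 ≤ g a b) (c : Fin n → Bool) (l : α → ℕ) (hl : ∑ j, l j = n)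
    (hpos : ∏ j, g j false ^ l j ≠ 0) :
    #{y : Fin n → α | (∀ j, #{i | y i = j} = l j) ∧
        ∏ i, g (y i) false ≤ ∏ i, g (y i) (c i)} ≤
      ∑ m : α → Fin (n + 1) with (∑ j, (m j : ℕ) = #{i | c i = true}) ∧
          (∀ j, (m j : ℕ) ≤ l j) ∧
          ∏ j, g j false ^ (m j : ℕ) ≤ ∏ j, g j true ^ (m j : ℕ),
        Nat.multinomial univ (fun j => (m j : ℕ)) *
          Nat.multinomial univ (fun j => l j - (m j : ℕ)) := by
  let σ : (Fin n → α) → α → Fin (n + 1) := fun y j =>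
    ⟨#{i | c i = true ∧ y i = j},
      Nat.lt_succ_of_le ((Finset.card_le_univ _).trans_eq (Fintype.card_fin n))⟩
  rw [Finset.card_eq_sum_card_fiberwise (f := σ)
    (t := {m : α → Fin (n + 1) | (∑ j, (m j : ℕ) = #{i | c i = true}) ∧
          (∀ j, (m j : ℕ) ≤ l j) ∧
          ∏ j, g j false ^ (m j : ℕ) ≤ ∏ j, g j true ^ (m j : ℕ)})]
  · refine Finset.sum_le_sum fun m hm => ?_
    simp only [Finset.mem_filter, Finset.mem_univ, true_and] at hm
    refine le_trans (Finset.card_le_card ?_) (card_filter_joint_type_le (fun i => c i = true) l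
      (fun j => (m j : ℕ)) (by simpa using hl) hm.1 hm.2.1)
    intro y hy
    simp only [Finset.mem_filter, Finset.mem_univ, true_and] at hy ⊢
    exact ⟨hy.1.1, fun j => by rw [← hy.2]⟩
  · intro y hy
    simp only [Finset.coe_filter, Finset.mem_univ, true_and, Set.mem_ofPred_eq] at hy ⊢
    refine ⟨?_, fun j => ?_, ?_⟩
    · have := Finset.card_eq_sum_card_fiberwise (s := ({i | c i = true} : Finset (Fin n)))
        (f := y) (t := univ) (fun _ _ => Finset.mem_coe.2 (Finset.mem_univ _))
      simp only [Finset.filter_filter] at this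
      exact this.symm
    · rw [← hy.1 j]
      change #{i | c i = true ∧ y i = j} ≤ _
      exact Finset.card_le_card fun i hi => by
        simp only [Finset.mem_filter, Finset.mem_univ, true_and] at hi ⊢
        exact hi.2
    · have hp : ∏ i, g (y i) false ≠ 0 := by
        have := prod_pow_card_filter (fun _ => True) y (fun a => g a false)
        simp only [true_and, Finset.filter_true, hy.1] at this
        rwa [← this]
      have := prod_support_le_of_prod_le g hg c y hp hy.2
      rw [← prod_pow_card_filter (fun i => c i = true) y (fun a => g a false),
        ← prod_pow_card_filter (fun i => c i = true) y (fun a => g a true)] at this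
      exact this

/-- Grouping the nonzero words of a code by their weight. -/
theorem sum_nonzero_eq_sum_weight {n d : ℕ} (C : Finset (Fin n → Bool))
    (hd : ∀ c ∈ C, c ≠ (fun _ => false) → d ≤ #{i | c i = true}) (F : ℕ → ℕ) :
    ∑ c ∈ C with c ≠ (fun _ => false), F #{i | c i = true} ≤
      ∑ w ∈ Finset.Icc d n, #{c ∈ C | #{i | c i = true} = w} * F w := by
  rw [← Finset.sum_fiberwise_of_maps_to (s := {c ∈ C | c ≠ fun _ => false})
    (t := Finset.Icc d n) (g := fun c => #{i | c i = true})]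
  · refine Finset.sum_le_sum fun w _ => ?_
    rw [Finset.sum_congr rfl (g := fun _ => F w)
      (fun c hc => by rw [(Finset.mem_filter.1 hc).2]), Finset.sum_const, smul_eq_mul]
    gcongr
    exact Finset.filter_subset _ _
  · intro c hc
    rw [Finset.mem_filter] at hc
    exact Finset.mem_Icc.2 ⟨hd c hc.1 hc.2,
      (Finset.card_le_univ _).trans_eq (Fintype.card_fin n)⟩

/-- **Extended Poltyrev bound for a BMS channel.**
The output alphabet is `{-M, …, M} ⊆ ℤ`, the transition probabilities are
`ε y x` (probability of output `y` given input `x : Bool`, `false ↔ 0`),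
nonnegative, summing to one, and symmetric (`ε y true = ε (-y) false`).
`C` is a binary linear code of length `n` with weight distribution `S` and
minimum distance `dmin`.  With the all-zero codeword transmitted, the
maximum-likelihood (worst-case tie-breaking) error probability `Pe` satisfies
the extended Poltyrev bound, where the outer sum ranges over all non-normalized
types `ℓ` of output vectors (nonnegative integer vectors summing to `n`) and
the inner sum over all conditional types `μ` (summing to `w`, dominated by `ℓ`)
satisfying the pairwise-error condition. -/
theorem extended_poltyrev_bound_BMS
    (M n : ℕ) (ε : ℤ → Bool → ℝ)
    (hnn : ∀ y x, 0 ≤ ε y x)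
    (hsum : ∀ x, ∑ y ∈ Finset.Icc (-(M : ℤ)) (M : ℤ), ε y x = 1)
    (hsym : ∀ y ∈ Finset.Icc (-(M : ℤ)) (M : ℤ), ε y true = ε (-y) false)
    (C : Finset (Fin n → Bool))
    (hzero : (fun _ => false) ∈ C)
    (hlin : ∀ c ∈ C, ∀ c' ∈ C, (fun i => Bool.xor (c i) (c' i)) ∈ C)
    (S : ℕ → ℕ)
    (hS : ∀ w, S w =
      (C.filter (fun c => (univ.filter (fun i => c i = true)).card = w)).card)
    (dmin : ℕ)
    (hdmin : IsLeast {w | ∃ c ∈ C, c ≠ (fun _ => false) ∧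
      (univ.filter (fun i => c i = true)).card = w} dmin)
    (Pe : ℝ)
    (hPe : Pe = ∑ y : Fin n → outAlphabet M,
      (∏ i, ε (y i : ℤ) false) *
        (if ∃ c ∈ C, c ≠ (fun _ => false) ∧
            (∏ i, ε (y i : ℤ) false) ≤ ∏ i, ε (y i : ℤ) (c i)
         then 1 else 0)) :
    Pe ≤
      ∑ ℓ ∈ (univ : Finset (outAlphabet M → Fin (n + 1))).filter
          (fun ℓ => ∑ j, (ℓ j : ℕ) = n),
        (∏ j : outAlphabet M, ε (j : ℤ) false ^ (ℓ j : ℕ)) *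
          min
            (∑ w ∈ Finset.Icc dmin n, (S w : ℝ) *
              ∑ μ ∈ (univ : Finset (outAlphabet M → Fin (n + 1))).filter
                  (fun μ => (∑ j, (μ j : ℕ) = w) ∧ (∀ j, (μ j : ℕ) ≤ (ℓ j : ℕ)) ∧
                    (∏ j : outAlphabet M, ε (j : ℤ) false ^ (μ j : ℕ)) ≤
                      ∏ j : outAlphabet M, ε (j : ℤ) true ^ (μ j : ℕ)),
                ((Nat.multinomial univ (fun j => (μ j : ℕ))) : ℝ) *
                  ((Nat.multinomial univ (fun j => (ℓ j : ℕ) - (μ j : ℕ))) : ℝ))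
            ((Nat.multinomial univ (fun j => (ℓ j : ℕ))) : ℝ) := by
  subst hPe
  let τ : (Fin n → outAlphabet M) → outAlphabet M → Fin (n + 1) := fun y j =>
    ⟨#{i | y i = j},
      Nat.lt_succ_of_le ((Finset.card_le_univ _).trans_eq (Fintype.card_fin n))⟩
  have hτ (y : Fin n → outAlphabet M) (ℓ : outAlphabet M → Fin (n + 1)) :
      τ y = ℓ ↔ ∀ j, #{i | y i = j} = (ℓ j : ℕ) := by
    simp only [τ, funext_iff, Fin.ext_iff]
  rw [← Finset.sum_fiberwise_of_maps_to (g := τ)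
    (t := (univ : Finset (outAlphabet M → Fin (n + 1))).filter
      (fun ℓ => ∑ j, (ℓ j : ℕ) = n))]
  swap
  · intro y _
    simp only [Finset.mem_filter, Finset.mem_univ, true_and]
    exact (Finset.card_eq_sum_card_fiberwise (s := univ) (f := y) (t := univ)
      (fun _ _ => Finset.mem_coe.2 (Finset.mem_univ _))).symm.trans (by simp)
  refine Finset.sum_le_sum fun ℓ hℓ => ?_
  have hℓn : ∑ j, (ℓ j : ℕ) = n := (Finset.mem_filter.1 hℓ).2
  set P := ∏ j : outAlphabet M, ε (j : ℤ) false ^ (ℓ j : ℕ) with hP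
  have hP0 : 0 ≤ P := Finset.prod_nonneg fun j _ => pow_nonneg (hnn _ _) _
  have hconst (y : Fin n → outAlphabet M) (hy : τ y = ℓ) :
      ∏ i, ε (y i : ℤ) false = P := by
    have := prod_pow_card_filter (fun _ => True) y (fun a => ε (a : ℤ) false)
    simp only [true_and, Finset.filter_true, (hτ y ℓ).1 hy] at this
    exact this.symm
  rw [Finset.sum_congr rfl fun y hy => by rw [hconst y (Finset.mem_filter.1 hy).2],
    ← Finset.mul_sum, Finset.sum_boole, Finset.filter_filter]
  by_cases hPz : P = 0
  · simp [hPz]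
  refine mul_le_mul_of_nonneg_left (le_min ?_ ?_) hP0
  · simp only [hS]
    norm_cast
    refine le_trans ?_ (sum_nonzero_eq_sum_weight C
      (fun c hc h0 => hdmin.2 ⟨c, hc, h0, rfl⟩) _)
    refine le_trans ?_ (Finset.sum_le_sum fun c _ =>
      card_pairwise_error_le (fun a : outAlphabet M => ε (a : ℤ)) (fun a => hnn a) c
        (fun j => (ℓ j : ℕ)) hℓn hPz)
    refine le_trans (Finset.card_le_card ?_) Finset.card_biUnion_le
    intro y hy
    simp only [Finset.mem_filter, Finset.mem_univ, true_and, Finset.mem_biUnion] at hy ⊢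
    obtain ⟨hy, c, hc, h0, hle⟩ := hy
    exact ⟨c, ⟨hc, h0⟩, (hτ y ℓ).1 hy, (hconst y hy).trans_le hle⟩
  · rw [← card_filter_type_eq_multinomial (ι := Fin n) _ (by simpa using hℓn)]
    norm_cast
    refine Finset.card_le_card fun y hy => ?_
    simp only [Finset.mem_filter, Finset.mem_univ, true_and] at hy ⊢
    exact (hτ y ℓ).1 hy.1

end
end

section
/- For transmission of a binary linear code over the binary symmetric channel BSC(ε) with crossover probability 0 < ε < 1/2, the maximum-likelihood decoding error probability satisfies the Poltyrev bound P_e ≤ Σ_{ℓ=0}^{n} ε^{ℓ}(1−ε)^{n−ℓ} · min{ Σ_{w=d_min}^{2ℓ} S_w Σ_{μ=⌈w/2⌉}^{min{ℓ,w}} (w choose μ)(n−w choose ℓ−μ), (n choose ℓ) }. -/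
/-!
The Poltyrev bound for the binary symmetric channel BSC(ε).
-/

open Finset

open scoped Classical

noncomputable section

/-- Transition probability of BSC(ε): output bit `y` given input bit `x`. -/
def bscTrans (ε : ℝ) (y x : Bool) : ℝ := if y = x then 1 - ε else ε

/-- The support of a binary word. -/
def wordSupport {n : ℕ} (y : Fin n → Bool) : Finset (Fin n) := univ.filter (fun i => y i = true)

lemma wordSupport_injective {n : ℕ} : Function.Injective (wordSupport (n := n)) := by
  intro y z h
  ext i
  have hi : y i = true ↔ z i = true := by simpa [wordSupport] using Finset.ext_iff.mp h i
  exact Bool.eq_iff_iff.mpr hi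

lemma card_filter_ne_add_two_mul_card_inter {n : ℕ} (y c : Fin n → Bool) :
    (univ.filter (fun i => y i ≠ c i)).card + 2 * (wordSupport y ∩ wordSupport c).card
      = (wordSupport y).card + (wordSupport c).card := by
  simp only [wordSupport, ← filter_and, card_filter, mul_sum, ← sum_add_distrib]
  refine sum_congr rfl fun i _ => ?_
  cases y i <;> cases c i <;> simp

lemma prod_bscTrans {n : ℕ} (ε : ℝ) (y c : Fin n → Bool) :
    ∏ i, bscTrans ε (y i) (c i) =
      ε ^ (univ.filter (fun i => y i ≠ c i)).card *
        (1 - ε) ^ (n - (univ.filter (fun i => y i ≠ c i)).card) := by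
  have h := card_filter_add_card_filter_not (s := (univ : Finset (Fin n))) (fun i => y i = c i)
  rw [card_univ, Fintype.card_fin] at h
  simp only [bscTrans, prod_ite, prod_const, ne_eq]
  rw [mul_comm, ← Nat.eq_sub_of_add_eq h]

lemma prod_bscTrans_false {n : ℕ} (ε : ℝ) (y : Fin n → Bool) :
    ∏ i, bscTrans ε (y i) false =
      ε ^ (wordSupport y).card * (1 - ε) ^ (n - (wordSupport y).card) := by
  simpa [wordSupport] using prod_bscTrans ε y (fun _ => false)

lemma sum_prod_bscTrans_false_mul_ite {n : ℕ} (ε : ℝ) (ℓ : ℕ) (E : (Fin n → Bool) → Prop)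
    [DecidablePred E] :
    ∑ y ∈ univ.filter (fun y : Fin n → Bool => (wordSupport y).card = ℓ),
      (∏ i, bscTrans ε (y i) false) * (if E y then (1 : ℝ) else 0) =
      ε ^ ℓ * (1 - ε) ^ (n - ℓ) *
        ((univ.filter (fun y => (wordSupport y).card = ℓ ∧ E y)).card : ℝ) := by
  rw [← filter_filter, card_filter, Nat.cast_sum, mul_sum]
  refine sum_congr rfl fun y hy => ?_
  rw [prod_bscTrans_false, (mem_filter.mp hy).2]
  push_cast
  rfl

lemma le_of_pow_mul_pow_le {n d l : ℕ} {ε : ℝ} (hε0 : 0 < ε) (hε1 : ε < 1 / 2) (hd : d ≤ n)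
    (h : ε ^ l * (1 - ε) ^ (n - l) ≤ ε ^ d * (1 - ε) ^ (n - d)) : d ≤ l := by
  by_contra! hlt
  obtain ⟨k, rfl⟩ := Nat.exists_eq_add_of_lt hlt
  have h1 : 0 < 1 - ε := by linarith
  have hk : ε ^ (k + 1) < (1 - ε) ^ (k + 1) :=
    pow_lt_pow_left₀ (by linarith) hε0.le (Nat.succ_ne_zero k)
  have hn : n - l = (k + 1) + (n - (l + k + 1)) := by omega
  rw [hn, pow_add, add_assoc l, pow_add ε, ← add_assoc l, mul_assoc] at h
  have h2 := le_of_mul_le_mul_left h (pow_pos hε0 l)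
  have h3 := le_of_mul_le_mul_right h2 (pow_pos h1 _)
  linarith

/-- If a codeword `c` is at least as likely as the zero word given `y`, then at least half of
the support of `c` is flipped. -/
lemma card_wordSupport_le_of_likelihood_le {n : ℕ} {ε : ℝ} (hε0 : 0 < ε) (hε1 : ε < 1 / 2)
    {y c : Fin n → Bool}
    (h : ∏ i, bscTrans ε (y i) false ≤ ∏ i, bscTrans ε (y i) (c i)) :
    (wordSupport c).card ≤ 2 * (wordSupport y ∩ wordSupport c).card := by
  rw [prod_bscTrans_false, prod_bscTrans] at h
  have hd := le_of_pow_mul_pow_le hε0 hε1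
    ((card_le_univ _).trans_eq (Fintype.card_fin n)) h
  have := card_filter_ne_add_two_mul_card_inter y c
  omega

lemma card_filter_wordSupport_le {n : ℕ} (ℓ : ℕ) :
    (univ.filter (fun y : Fin n → Bool => (wordSupport y).card = ℓ)).card ≤ n.choose ℓ := by
  have : n.choose ℓ = (powersetCard ℓ (univ : Finset (Fin n))).card := by simp
  rw [this]
  refine card_le_card_of_injOn wordSupport (fun y hy => ?_) wordSupport_injective.injOn
  simpa [mem_powersetCard] using hy

lemma card_filter_wordSupport_inter_le {n : ℕ} (c : Fin n → Bool) (ℓ μ : ℕ) :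
    (univ.filter (fun y : Fin n → Bool =>
      (wordSupport y).card = ℓ ∧ (wordSupport y ∩ wordSupport c).card = μ)).card ≤
      (wordSupport c).card.choose μ * (n - (wordSupport c).card).choose (ℓ - μ) := by
  have : (wordSupport c).card.choose μ * (n - (wordSupport c).card).choose (ℓ - μ) =
      (powersetCard μ (wordSupport c) ×ˢ powersetCard (ℓ - μ) (wordSupport c)ᶜ).card := by
    simp [card_compl]
  rw [this]
  refine card_le_card_of_injOn
    (fun y => (wordSupport y ∩ wordSupport c, wordSupport y \ wordSupport c)) (fun y hy => ?_) ?_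
  · obtain ⟨h1, h2⟩ := (mem_filter.mp (mem_coe.mp hy)).2
    have h3 := card_inter_add_card_sdiff (wordSupport y) (wordSupport c)
    simp only [coe_product, Set.mem_prod, mem_coe, mem_powersetCard]
    refine ⟨⟨inter_subset_right, h2⟩, fun i hi => ?_, by omega⟩
    exact mem_compl.mpr (mem_sdiff.mp hi).2
  · intro y _ z _ h
    obtain ⟨h1, h2⟩ := Prod.mk.inj h
    apply wordSupport_injective
    rw [← sup_inf_sdiff (wordSupport y) (wordSupport c), ← sup_inf_sdiff (wordSupport z)
      (wordSupport c)]
    exact congrArg₂ (· ⊔ ·) h1 h2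

/-- Union bound on the number of words of weight `ℓ` that cover at least half of the support
of some nonzero codeword. -/
lemma card_filter_covers_half_le {n : ℕ} (C : Finset (Fin n → Bool)) (dmin ℓ : ℕ)
    (hdmin : ∀ c ∈ C, c ≠ (fun _ => false) → dmin ≤ (wordSupport c).card) :
    (univ.filter (fun y : Fin n → Bool => (wordSupport y).card = ℓ ∧
      ∃ c ∈ C, c ≠ (fun _ => false) ∧
        (wordSupport c).card ≤ 2 * (wordSupport y ∩ wordSupport c).card)).card ≤
      ∑ w ∈ Icc dmin (2 * ℓ), (C.filter (fun c => (wordSupport c).card = w)).card *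
        ∑ μ ∈ Icc ((w + 1) / 2) (min ℓ w), w.choose μ * (n - w).choose (ℓ - μ) := by
  have hsub : univ.filter (fun y : Fin n → Bool => (wordSupport y).card = ℓ ∧
      ∃ c ∈ C, c ≠ (fun _ => false) ∧
        (wordSupport c).card ≤ 2 * (wordSupport y ∩ wordSupport c).card) ⊆
      (Icc dmin (2 * ℓ)).biUnion fun w =>
        (C.filter (fun c => (wordSupport c).card = w)).biUnion fun c =>
          (Icc ((w + 1) / 2) (min ℓ w)).biUnion fun μ =>
            univ.filter (fun y : Fin n → Bool =>
              (wordSupport y).card = ℓ ∧ (wordSupport y ∩ wordSupport c).card = μ) := by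
    intro y hy
    obtain ⟨hl, c, hc, hc0, hle⟩ := (mem_filter.mp hy).2
    have h1 := hdmin c hc hc0
    have h2 := card_le_card (inter_subset_left (s₁ := wordSupport y) (s₂ := wordSupport c))
    have h3 := card_le_card (inter_subset_right (s₁ := wordSupport y) (s₂ := wordSupport c))
    simp only [mem_biUnion, mem_filter, mem_univ, true_and, mem_Icc]
    exact ⟨_, ⟨h1, by omega⟩, c, ⟨hc, rfl⟩, _, ⟨by omega, by omega⟩, hl, rfl⟩
  refine (card_le_card hsub).trans (card_biUnion_le.trans (sum_le_sum fun w _ => ?_))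
  refine card_biUnion_le.trans ((sum_le_card_nsmul _ _ _ fun c hc => ?_).trans_eq (smul_eq_mul _ _))
  obtain rfl := (mem_filter.mp hc).2
  exact card_biUnion_le.trans
    (sum_le_sum fun μ _ => card_filter_wordSupport_inter_le c ℓ μ)

/-- **Poltyrev bound for the BSC.**
`C` is a binary linear code of length `n` with weight distribution `S` and
minimum distance `dmin`, used over a BSC with crossover probability
`0 < ε < 1/2`.  With the all-zero codeword transmitted, the maximum-likelihood
(worst-case tie-breaking) decoding error probability `Pe` satisfies
`Pe ≤ ∑_{ℓ=0}^{n} ε^ℓ (1-ε)^{n-ℓ}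
   min{ ∑_{w=dmin}^{2ℓ} S_w ∑_{μ=⌈w/2⌉}^{min{ℓ,w}} (w choose μ)(n-w choose ℓ-μ),
        (n choose ℓ) }`. -/
theorem poltyrev_bound_BSC
    (n : ℕ) (ε : ℝ) (hε0 : 0 < ε) (hε1 : ε < 1 / 2)
    (C : Finset (Fin n → Bool))
    (hzero : (fun _ => false) ∈ C)
    (hlin : ∀ c ∈ C, ∀ c' ∈ C, (fun i => Bool.xor (c i) (c' i)) ∈ C)
    (S : ℕ → ℕ)
    (hS : ∀ w, S w =
      (C.filter (fun c => (univ.filter (fun i => c i = true)).card = w)).card)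
    (dmin : ℕ)
    (hdmin : IsLeast {w | ∃ c ∈ C, c ≠ (fun _ => false) ∧
      (univ.filter (fun i => c i = true)).card = w} dmin)
    (Pe : ℝ)
    (hPe : Pe = ∑ y : Fin n → Bool,
      (∏ i, bscTrans ε (y i) false) *
        (if ∃ c ∈ C, c ≠ (fun _ => false) ∧
            (∏ i, bscTrans ε (y i) false) ≤ ∏ i, bscTrans ε (y i) (c i)
         then 1 else 0)) :
    Pe ≤
      ∑ ℓ ∈ Finset.range (n + 1),
        ε ^ ℓ * (1 - ε) ^ (n - ℓ) *
          min
            (∑ w ∈ Finset.Icc dmin (2 * ℓ), (S w : ℝ) *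
              ∑ μ ∈ Finset.Icc ((w + 1) / 2) (min ℓ w),
                ((w.choose μ : ℕ) : ℝ) * (((n - w).choose (ℓ - μ) : ℕ) : ℝ))
            ((n.choose ℓ : ℕ) : ℝ) := by
  have h1 : 0 < 1 - ε := by linarith
  have hmaps : ∀ y ∈ (univ : Finset (Fin n → Bool)), (wordSupport y).card ∈ range (n + 1) :=
    fun y _ => mem_range_succ_iff.mpr ((card_le_univ _).trans_eq (Fintype.card_fin n))
  rw [hPe, ← sum_fiberwise_of_maps_to hmaps]
  refine sum_le_sum fun ℓ _ => ?_
  refine (sum_prod_bscTrans_false_mul_ite ε ℓ _).trans_le (mul_le_mul_of_nonneg_left (le_min ?_ ?_) (by positivity))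
  · have hcover := card_filter_covers_half_le C dmin ℓ
      (fun c hc hc0 => hdmin.2 ⟨c, hc, hc0, rfl⟩)
    simp only [hS]
    refine le_trans (Nat.cast_le.mpr (card_le_card (monotone_filter_right _ ?_)))
      (mod_cast hcover)
    rintro y _ ⟨hl, c, hc, hc0, h⟩
    exact ⟨hl, c, hc, hc0, card_wordSupport_le_of_likelihood_le hε0 hε1 h⟩
  · refine Nat.cast_le.mpr (le_trans (card_le_card (monotone_filter_right _ ?_))
      (card_filter_wordSupport_le ℓ))
    exact fun y _ h => h.1

end
end

section
/- For transmission of a binary linear code over the binary erasure channel BEC(δ) with erasure probability 0 ≤ δ < 1, the maximum-likelihood decoding error probability satisfies P_e ≤ Σ_{ℓ=0}^{n} δ^{ℓ}(1−δ)^{n−ℓ} · min{ Σ_{w=d_min}^{n} S_w (n−w choose ℓ−w), (n choose ℓ) }, where (n−w choose ℓ−w) = 0 when ℓ < w. -/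
/-!
The extended Poltyrev bound specialized to the binary erasure channel BEC(δ).
-/

open Finset

open scoped Classical

noncomputable section

/-- Output alphabet `{-1, 0, 1}` of the BEC (0 is the erasure symbol). -/
abbrev becAlphabet : Type := ↥({-1, 0, 1} : Finset ℤ)

/-- Transition probability of BEC(δ): given input bit `x` (`false ↔ 0`,
`true ↔ 1`), the output is `-1`/`+1` ("bit read correctly") with probability
`1 - δ`, the erasure symbol `0` with probability `δ`, and the opposite symbol
with probability `0`. -/
def becTrans (δ : ℝ) (y : ℤ) (x : Bool) : ℝ :=
  if y = 0 then δ else if y = (if x then 1 else -1) then 1 - δ else 0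

theorem card_supersets_le {n : ℕ} (A : Finset (Fin n)) (l : ℕ) :
    ((powersetCard l univ).filter (fun E => A ⊆ E)).card ≤
      if A.card ≤ l then (n - A.card).choose (l - A.card) else 0 := by
  split_ifs with h
  · calc _ ≤ (powersetCard (l - A.card) Aᶜ).card := by
          refine card_le_card_of_injOn (fun E => E \ A) ?_ ?_
          · intro E hE
            simp only [coe_filter, mem_powersetCard, subset_univ, true_and,
              Set.mem_ofPred_eq] at hE
            simp only [mem_coe, mem_powersetCard]
            refine ⟨fun x hx => ?_, ?_⟩
            · simp only [mem_sdiff] at hx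
              simpa using hx.2
            · rw [card_sdiff_of_subset hE.2, hE.1]
          · intro E hE F hF hEF
            simp only [coe_filter, Set.mem_ofPred_eq] at hE hF
            rw [← sdiff_union_of_subset hE.2, ← sdiff_union_of_subset hF.2]
            exact congrArg (· ∪ A) hEF
      _ = _ := by rw [card_powersetCard, card_compl, Fintype.card_fin]
  · rw [Nat.le_zero, card_eq_zero, filter_eq_empty_iff]
    intro E hE hAE
    rw [mem_powersetCard] at hE
    exact h (hE.2 ▸ card_le_card hAE)

/-- The output word whose erasures are exactly `E`, all other symbols being `-1`. -/
def erasureWord {n : ℕ} (E : Finset (Fin n)) : Fin n → becAlphabet :=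
  fun i => if i ∈ E then ⟨0, by simp⟩ else ⟨-1, by simp⟩

theorem coe_erasureWord {n : ℕ} (E : Finset (Fin n)) (i : Fin n) :
    (erasureWord E i : ℤ) = if i ∈ E then 0 else -1 := by
  unfold erasureWord
  split_ifs <;> rfl

theorem erasureWord_injective {n : ℕ} :
    Function.Injective (erasureWord : Finset (Fin n) → Fin n → becAlphabet) := by
  intro E F h
  ext i
  have hi := congrArg (fun y : Fin n → becAlphabet => (y i : ℤ)) h
  simp only [coe_erasureWord] at hi
  by_cases hE : i ∈ E <;> by_cases hF : i ∈ F <;> simp_all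

theorem prod_becTrans_erasureWord {n : ℕ} (δ : ℝ) (E : Finset (Fin n)) :
    ∏ i, becTrans δ (erasureWord E i : ℤ) false = δ ^ E.card * (1 - δ) ^ (n - E.card) := by
  have h : ∀ i, becTrans δ (erasureWord E i : ℤ) false = if i ∈ E then δ else 1 - δ := by
    intro i
    rw [coe_erasureWord]
    split_ifs <;> simp [becTrans]
  have hc : (univ.filter (fun i => i ∉ E)) = Eᶜ := by ext; simp
  simp only [h, prod_ite, prod_const, hc, card_compl, Fintype.card_fin, filter_univ_mem]

theorem prod_becTrans_eq_zero {n : ℕ} (δ : ℝ) (y : Fin n → becAlphabet)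
    (hy : y ∉ Set.range erasureWord) : ∏ i, becTrans δ (y i : ℤ) false = 0 := by
  by_contra hne
  refine hy ⟨univ.filter (fun i => (y i : ℤ) = 0), ?_⟩
  funext i
  apply Subtype.ext
  rw [coe_erasureWord]
  have hi := (prod_ne_zero_iff.mp hne) i (mem_univ i)
  by_cases h0 : (y i : ℤ) = 0
  · simp [h0]
  · by_cases h1 : (y i : ℤ) = -1
    · simp [h1]
    · simp [becTrans, h0, h1] at hi

/-- If `c` is at least as likely as zero given the positive-probability erasure pattern `E`,
then `c` is supported on `E`. -/
theorem support_subset_of_prod_le {n : ℕ} {δ : ℝ} {E : Finset (Fin n)} {c : Fin n → Bool}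
    (hpos : 0 < ∏ i, becTrans δ (erasureWord E i : ℤ) false)
    (hle : ∏ i, becTrans δ (erasureWord E i : ℤ) false ≤
      ∏ i, becTrans δ (erasureWord E i : ℤ) (c i)) :
    univ.filter (fun i => c i = true) ⊆ E := by
  intro i hi
  rw [mem_filter] at hi
  by_contra hE
  have h := prod_ne_zero_iff.mp (hpos.trans_le hle).ne' i (mem_univ i)
  simp [coe_erasureWord, hE, hi.2, becTrans] at h

/-- Union bound on the number of `l`-sets covering the support of a nonzero codeword. -/
theorem card_covering_sets_le {n : ℕ} (C : Finset (Fin n → Bool)) (dmin l : ℕ)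
    (hmin : ∀ c ∈ C, c ≠ (fun _ => false) →
      dmin ≤ (univ.filter (fun i => c i = true)).card) :
    ((powersetCard l univ).filter (fun E => ∃ c ∈ C, c ≠ (fun _ => false) ∧
      univ.filter (fun i => c i = true) ⊆ E)).card ≤
    ∑ w ∈ Icc dmin n, (C.filter (fun c => (univ.filter (fun i => c i = true)).card = w)).card *
      (if w ≤ l then (n - w).choose (l - w) else 0) := by
  set wt : (Fin n → Bool) → ℕ := fun c => (univ.filter (fun i => c i = true)).card with hwt
  set N : ℕ → ℕ := fun w => if w ≤ l then (n - w).choose (l - w) else 0 with hN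
  set D := C.filter (fun c => c ≠ fun _ => false) with hD
  have hmaps : ∀ c ∈ D, wt c ∈ Icc dmin n := by
    intro c hc
    rw [hD, mem_filter] at hc
    exact mem_Icc.mpr ⟨hmin c hc.1 hc.2, by simpa using card_le_univ (univ.filter (c · = true))⟩
  calc _ ≤ (D.biUnion fun c => (powersetCard l univ).filter
            (fun E => univ.filter (fun i => c i = true) ⊆ E)).card := by
        refine card_le_card fun E hE => ?_
        obtain ⟨hE, c, hc, hc0, hcE⟩ := mem_filter.mp hE
        exact mem_biUnion.mpr ⟨c, mem_filter.mpr ⟨hc, hc0⟩, mem_filter.mpr ⟨hE, hcE⟩⟩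
    _ ≤ ∑ c ∈ D, N (wt c) :=
        card_biUnion_le.trans (sum_le_sum fun c _ => card_supersets_le _ l)
    _ = ∑ w ∈ Icc dmin n, ∑ c ∈ D with wt c = w, N (wt c) :=
        (sum_fiberwise_of_maps_to hmaps _).symm
    _ ≤ _ := by
        refine sum_le_sum fun w _ => ?_
        rw [sum_congr rfl (g := fun _ => N w) (fun c hc => by rw [(mem_filter.mp hc).2]),
          sum_const, smul_eq_mul]
        exact Nat.mul_le_mul_right _ (card_le_card (filter_subset_filter _ (filter_subset _ _)))

/-- **Poltyrev-type bound for the BEC.**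
`C` is a binary linear code of length `n` with weight distribution `S` and
minimum distance `dmin`, used over a BEC with erasure probability `0 ≤ δ < 1`.
With the all-zero codeword transmitted, the maximum-likelihood (worst-case
tie-breaking) decoding error probability `Pe` satisfies
`Pe ≤ ∑_{ℓ=0}^{n} δ^ℓ (1-δ)^{n-ℓ}
   min{ ∑_{w=dmin}^{n} S_w (n-w choose ℓ-w), (n choose ℓ) }`,
where `(n-w choose ℓ-w) = 0` when `ℓ < w`. -/
theorem poltyrev_bound_BEC
    (n : ℕ) (δ : ℝ) (hδ0 : 0 ≤ δ) (hδ1 : δ < 1)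
    (C : Finset (Fin n → Bool))
    (hzero : (fun _ => false) ∈ C)
    (hlin : ∀ c ∈ C, ∀ c' ∈ C, (fun i => Bool.xor (c i) (c' i)) ∈ C)
    (S : ℕ → ℕ)
    (hS : ∀ w, S w =
      (C.filter (fun c => (univ.filter (fun i => c i = true)).card = w)).card)
    (dmin : ℕ)
    (hdmin : IsLeast {w | ∃ c ∈ C, c ≠ (fun _ => false) ∧
      (univ.filter (fun i => c i = true)).card = w} dmin)
    (Pe : ℝ)
    (hPe : Pe = ∑ y : Fin n → becAlphabet,
      (∏ i, becTrans δ (y i : ℤ) false) *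
        (if ∃ c ∈ C, c ≠ (fun _ => false) ∧
            (∏ i, becTrans δ (y i : ℤ) false) ≤ ∏ i, becTrans δ (y i : ℤ) (c i)
         then 1 else 0)) :
    Pe ≤
      ∑ ℓ ∈ Finset.range (n + 1),
        δ ^ ℓ * (1 - δ) ^ (n - ℓ) *
          min
            (∑ w ∈ Finset.Icc dmin n, (S w : ℝ) *
              (if w ≤ ℓ then (((n - w).choose (ℓ - w) : ℕ) : ℝ) else 0))
            ((n.choose ℓ : ℕ) : ℝ) := by
  subst hPe
  have hδ : 0 ≤ 1 - δ := by linarith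
  have hmin : ∀ c ∈ C, c ≠ (fun _ => false) →
      dmin ≤ (univ.filter (fun i => c i = true)).card :=
    fun c hc hc0 => hdmin.2 ⟨c, hc, hc0, rfl⟩
  set covers : Finset (Fin n) → Prop := fun E => ∃ c ∈ C, c ≠ (fun _ => false) ∧
    univ.filter (fun i => c i = true) ⊆ E with hcovers
  calc _ = ∑ E : Finset (Fin n), (∏ i, becTrans δ (erasureWord E i : ℤ) false) *
        (if ∃ c ∈ C, c ≠ (fun _ => false) ∧
            (∏ i, becTrans δ (erasureWord E i : ℤ) false) ≤
              ∏ i, becTrans δ (erasureWord E i : ℤ) (c i)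
         then 1 else 0) := by
        refine (sum_of_injOn erasureWord erasureWord_injective.injOn (by simp) ?_
          (fun _ _ => rfl)).symm
        intro y _ hy
        rw [prod_becTrans_eq_zero δ y (by simpa using hy), zero_mul]
    _ ≤ ∑ E : Finset (Fin n), δ ^ E.card * (1 - δ) ^ (n - E.card) *
          (if covers E then 1 else 0) := by
        refine sum_le_sum fun E _ => ?_
        have hp := prod_becTrans_erasureWord δ E
        have hnn : 0 ≤ δ ^ E.card * (1 - δ) ^ (n - E.card) := by positivity
        rcases hnn.eq_or_lt with h0 | hpos
        · rw [hp, ← h0, zero_mul, zero_mul]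
        · rw [← hp] at hpos ⊢
          refine mul_le_mul_of_nonneg_left ?_ hpos.le
          split_ifs with h1 h2
          · exact le_rfl
          · obtain ⟨c, hc, hc0, hle⟩ := h1
            exact absurd ⟨c, hc, hc0, support_subset_of_prod_le hpos hle⟩ h2
          · exact zero_le_one
          · exact le_rfl
    _ = ∑ l ∈ range (n + 1), δ ^ l * (1 - δ) ^ (n - l) *
          (((powersetCard l univ).filter covers).card : ℝ) := by
        rw [← powerset_univ, sum_powerset, card_univ, Fintype.card_fin]
        refine sum_congr rfl fun l _ => ?_
        rw [← sum_boole, mul_sum]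
        exact sum_congr rfl fun E hE => by rw [(mem_powersetCard.mp hE).2]
    _ ≤ _ := by
        refine sum_le_sum fun l _ => mul_le_mul_of_nonneg_left (le_min ?_ ?_) (by positivity)
        · simp only [hS]
          exact_mod_cast card_covering_sets_le C dmin l hmin
        · have h := card_filter_le (powersetCard l (univ : Finset (Fin n))) covers
          rw [card_powersetCard, card_univ, Fintype.card_fin] at h
          exact_mod_cast h

end
end

section
/- For transmission of a binary linear code over the hybrid BSC-BEC channel with flip probability ε and erasure probability δ, where ε > 0 and 2ε + δ < 1, the maximum-likelihood decoding error probability satisfies P_e ≤ Σ_{ℓ=0}^{n} Σ_{u=0}^{n−ℓ} ε^{ℓ} δ^{u} (1−ε−δ)^{n−ℓ−u} · min{ Σ_{w=d_min}^{n} S_w Σ_{ρ=0}^{min{u,w}} Σ_{μ=⌈(w−ρ)/2⌉}^{min{ℓ,w}} (w choose μ, ρ, w−μ−ρ)(n−w choose ℓ−μ, u−ρ, n−w−(ℓ−μ)−(u−ρ)), (n choose ℓ, u, n−ℓ−u) }, where multinomial coefficients with a negative entry are 0 and the inner sum over μ is further restricted to μ + ρ ≤ w. -/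
/-!
The extended Poltyrev bound specialized to the hybrid BSC-BEC(ε, δ) channel.
-/

open Finset

open scoped Classical

noncomputable section

/-- Output alphabet `{-1, 0, 1}` of the hybrid BSC-BEC channel
(0 is the erasure symbol). -/
abbrev hybridAlphabet : Type := ↥({-1, 0, 1} : Finset ℤ)

/-- Transition probability of the hybrid BSC-BEC(ε, δ) channel: given input bit
`x` (`false ↔ 0`, `true ↔ 1`), the output is the correct symbol (`-1` for input
`0`, `+1` for input `1`) with probability `1 - ε - δ`, the erasure symbol `0`
with probability `δ`, and the flipped symbol with probability `ε`. -/
def hybridTrans (ε δ : ℝ) (y : ℤ) (x : Bool) : ℝ :=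
  if y = 0 then δ else if y = (if x then 1 else -1) then 1 - ε - δ else ε

/-- Trinomial coefficient `(N choose a, b, N - a - b)`, equal to `0` when the
third entry `N - a - b` would be negative (i.e. when `a + b > N`). -/
def trinom (N a b : ℕ) : ℕ :=
  if a + b ≤ N then N.choose a * (N - a).choose b else 0

/-- The positions of `s` at which the received word `y` has the symbol `k`. -/
def symbolSet {ι : Type*} (y : ι → hybridAlphabet) (s : Finset ι) (k : ℤ) : Finset ι :=
  s.filter fun i => (y i : ℤ) = k

theorem trinom_eq (N a b : ℕ) : trinom N a b = N.choose a * (N - a).choose b := by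
  unfold trinom
  split_ifs with h
  · rfl
  · rcases lt_or_ge N a with ha | ha
    · simp [Nat.choose_eq_zero_of_lt ha]
    · rw [Nat.choose_eq_zero_of_lt (by omega : N - a < b), mul_zero]

/-- Disjoint pairs of subsets of `s` with `a` and `b` elements. -/
def disjointPairs {ι : Type*} (s : Finset ι) (a b : ℕ) : Finset (Σ _ : Finset ι, Finset ι) :=
  (s.powersetCard a).sigma fun A => (s \ A).powersetCard b

theorem card_disjointPairs {ι : Type*} (s : Finset ι) (a b : ℕ) :
    (disjointPairs s a b).card = trinom s.card a b := by
  rw [disjointPairs, card_sigma, trinom_eq, ← card_powersetCard a s, ← smul_eq_mul]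
  refine sum_eq_card_nsmul fun A hA => ?_
  rw [mem_powersetCard] at hA
  rw [card_powersetCard, card_sdiff_of_subset hA.1, hA.2]

theorem symbolSet_mem_disjointPairs {ι : Type*} (y : ι → hybridAlphabet) (s : Finset ι) :
    (⟨symbolSet y s 1, symbolSet y s 0⟩ : Σ _ : Finset ι, Finset ι) ∈
      disjointPairs s (symbolSet y s 1).card (symbolSet y s 0).card := by
  simp only [disjointPairs, mem_sigma, mem_powersetCard, and_true]
  refine ⟨filter_subset _ _, fun i hi => ?_⟩
  simp only [symbolSet, mem_filter, mem_sdiff] at hi ⊢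
  simp [hi.1, hi.2]

theorem hybridAlphabet_cases (a : hybridAlphabet) : (a : ℤ) = -1 ∨ (a : ℤ) = 0 ∨ (a : ℤ) = 1 := by
  have h := a.2
  simp only [mem_insert, mem_singleton] at h
  exact h

/-- A received word is determined by the positions of its flips and erasures. -/
theorem eq_of_symbolSet_eq {ι : Type*} {y z : ι → hybridAlphabet} {s : Finset ι}
    (h₁ : symbolSet y s 1 = symbolSet z s 1) (h₀ : symbolSet y s 0 = symbolSet z s 0)
    {i : ι} (hi : i ∈ s) : y i = z i := by
  have e₁ := Finset.ext_iff.1 h₁ i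
  have e₀ := Finset.ext_iff.1 h₀ i
  simp only [symbolSet, mem_filter, hi, true_and] at e₁ e₀
  apply Subtype.ext
  rcases hybridAlphabet_cases (y i) with h | h | h <;>
    rcases hybridAlphabet_cases (z i) with h' | h' | h' <;> simp_all

theorem card_filter_symbolSet_le {ι : Type*} [Fintype ι] [DecidableEq ι] (a b : ℕ) :
    (univ.filter fun y : ι → hybridAlphabet =>
      (symbolSet y univ 1).card = a ∧ (symbolSet y univ 0).card = b).card ≤
      trinom (Fintype.card ι) a b := by
  rw [← card_univ, ← card_disjointPairs]
  refine card_le_card_of_injOn (fun y => ⟨symbolSet y univ 1, symbolSet y univ 0⟩) ?_ ?_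
  · intro y hy
    obtain ⟨-, rfl, rfl⟩ := mem_filter.1 hy
    exact symbolSet_mem_disjointPairs y univ
  · intro y _ z _ h
    simp only [Sigma.mk.injEq, heq_eq_eq] at h
    exact funext fun i => eq_of_symbolSet_eq h.1 h.2 (mem_univ i)

theorem card_filter_symbolSet_split_le {ι : Type*} [Fintype ι] [DecidableEq ι]
    (s : Finset ι) (a b c d : ℕ) :
    (univ.filter fun y : ι → hybridAlphabet =>
      ((symbolSet y s 1).card = a ∧ (symbolSet y s 0).card = b) ∧
        (symbolSet y sᶜ 1).card = c ∧ (symbolSet y sᶜ 0).card = d).card ≤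
      trinom s.card a b * trinom (Fintype.card ι - s.card) c d := by
  rw [← card_compl, ← card_disjointPairs, ← card_disjointPairs, ← card_product]
  refine card_le_card_of_injOn (fun y =>
    (⟨symbolSet y s 1, symbolSet y s 0⟩, ⟨symbolSet y sᶜ 1, symbolSet y sᶜ 0⟩)) ?_ ?_
  · intro y hy
    obtain ⟨-, ⟨rfl, rfl⟩, rfl, rfl⟩ := mem_filter.1 hy
    exact mem_product.2 ⟨symbolSet_mem_disjointPairs y s, symbolSet_mem_disjointPairs y sᶜ⟩
  · intro y _ z _ h
    simp only [Prod.mk.injEq, Sigma.mk.injEq, heq_eq_eq] at h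
    funext i
    by_cases hi : i ∈ s
    · exact eq_of_symbolSet_eq h.1.1 h.1.2 hi
    · exact eq_of_symbolSet_eq h.2.1 h.2.2 (mem_compl.2 hi)

theorem prod_comp_symbol {ι : Type*} (y : ι → hybridAlphabet) (s : Finset ι) (f : ℤ → ℝ) :
    ∏ i ∈ s, f (y i) = f 1 ^ (symbolSet y s 1).card * f 0 ^ (symbolSet y s 0).card *
      f (-1) ^ (symbolSet y s (-1)).card := by
  rw [← prod_fiberwise_of_maps_to' (t := ({1, 0, -1} : Finset ℤ)) (g := fun i => (y i : ℤ))
    (fun i _ => by rcases hybridAlphabet_cases (y i) with h | h | h <;> simp [h]) f]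
  simp [symbolSet, mul_assoc]

theorem card_symbolSet_sum {ι : Type*} (y : ι → hybridAlphabet) (s : Finset ι) :
    (symbolSet y s 1).card + (symbolSet y s 0).card + (symbolSet y s (-1)).card = s.card := by
  have h := card_eq_sum_card_fiberwise (s := s) (t := ({1, 0, -1} : Finset ℤ))
    (f := fun i => (y i : ℤ))
    (fun i _ => by rcases hybridAlphabet_cases (y i) with h | h | h <;> simp [h])
  simp [h, symbolSet, add_assoc]

theorem card_symbolSet_add_compl {ι : Type*} [Fintype ι] [DecidableEq ι]
    (y : ι → hybridAlphabet) (s : Finset ι) (k : ℤ) :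
    (symbolSet y s k).card + (symbolSet y sᶜ k).card = (symbolSet y univ k).card := by
  rw [symbolSet, symbolSet, ← card_union_of_disjoint
    (disjoint_filter_filter disjoint_compl_right), ← filter_union, union_compl, symbolSet]

theorem prod_hybridTrans_false {ι : Type*} (ε δ : ℝ) (y : ι → hybridAlphabet) (s : Finset ι) :
    ∏ i ∈ s, hybridTrans ε δ (y i) false = ε ^ (symbolSet y s 1).card *
      δ ^ (symbolSet y s 0).card * (1 - ε - δ) ^ (symbolSet y s (-1)).card := by
  rw [prod_comp_symbol y s fun k => hybridTrans ε δ k false]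
  norm_num [hybridTrans]

theorem prod_hybridTrans_true {ι : Type*} (ε δ : ℝ) (y : ι → hybridAlphabet) (s : Finset ι) :
    ∏ i ∈ s, hybridTrans ε δ (y i) true = (1 - ε - δ) ^ (symbolSet y s 1).card *
      δ ^ (symbolSet y s 0).card * ε ^ (symbolSet y s (-1)).card := by
  rw [prod_comp_symbol y s fun k => hybridTrans ε δ k true]
  norm_num [hybridTrans]

theorem le_of_pow_mul_pow_le_s3 {a b : ℝ} (ha : 0 < a) (hab : a < b) {m k : ℕ}
    (h : a ^ m * b ^ k ≤ b ^ m * a ^ k) : k ≤ m := by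
  by_contra! hlt
  obtain ⟨j, rfl⟩ := Nat.exists_eq_add_of_lt hlt
  have hb : 0 < b := ha.trans hab
  have hpow : a ^ (j + 1) < b ^ (j + 1) := pow_lt_pow_left₀ hab ha.le j.succ_ne_zero
  have hpos : 0 < a ^ m * b ^ m := by positivity
  have := mul_lt_mul_of_pos_left hpow hpos
  rw [add_assoc, pow_add b, pow_add a] at h
  linarith

/-- A codeword supported on `s` is at least as likely as the zero word only if, on `s`,
there are at least as many flips as correctly received symbols. -/
theorem card_correct_le_card_flips {ι : Type*} [Fintype ι] {ε δ : ℝ} (hε : 0 < ε) (hδ : 0 ≤ δ)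
    (hεδ : 2 * ε + δ < 1) {y : ι → hybridAlphabet} {c : ι → Bool}
    (hy : ∏ i, hybridTrans ε δ (y i) false ≠ 0)
    (h : ∏ i, hybridTrans ε δ (y i) false ≤ ∏ i, hybridTrans ε δ (y i) (c i)) :
    (symbolSet y (univ.filter fun i => c i = true) (-1)).card ≤
      (symbolSet y (univ.filter fun i => c i = true) 1).card := by
  set s := univ.filter fun i => c i = true with hs
  have hp : 0 < 1 - ε - δ := by linarith
  rw [← prod_mul_prod_compl s] at hy
  have htrue : ∏ i ∈ s, hybridTrans ε δ (y i) (c i) = ∏ i ∈ s, hybridTrans ε δ (y i) true :=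
    prod_congr rfl fun i hi => by rw [(mem_filter.1 hi).2]
  have hfalse : ∏ i ∈ sᶜ, hybridTrans ε δ (y i) (c i) = ∏ i ∈ sᶜ, hybridTrans ε δ (y i) false :=
    prod_congr rfl fun i hi => by
      have : c i = false := by simpa [hs] using hi
      rw [this]
  rw [← prod_mul_prod_compl s, ← prod_mul_prod_compl s fun i => hybridTrans ε δ (y i) (c i),
    htrue, hfalse] at h
  have hcompl : 0 < ∏ i ∈ sᶜ, hybridTrans ε δ (y i) false := by
    refine lt_of_le_of_ne ?_ (right_ne_zero_of_mul hy).symm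
    rw [prod_hybridTrans_false]
    positivity
  have hs₀ := left_ne_zero_of_mul hy
  have hle := le_of_mul_le_mul_right h hcompl
  rw [prod_hybridTrans_false] at hs₀ hle
  rw [prod_hybridTrans_true] at hle
  have hδs : 0 < δ ^ (symbolSet y s 0).card :=
    lt_of_le_of_ne (by positivity) (right_ne_zero_of_mul (left_ne_zero_of_mul hs₀)).symm
  refine le_of_pow_mul_pow_le_s3 hε (by linarith : ε < 1 - ε - δ)
    (le_of_mul_le_mul_left ?_ hδs)
  linarith

/-- Union bound over the codewords and over the numbers `ρ` of erasures and `μ` of flips on the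
support of a codeword. -/
theorem card_dominated_le {n : ℕ} (C : Finset (Fin n → Bool)) (S : ℕ → ℕ)
    (hS : ∀ w, S w = (C.filter fun c => (univ.filter fun i => c i = true).card = w).card)
    (d ℓ u : ℕ)
    (hd : ∀ c ∈ C, c ≠ (fun _ => false) → d ≤ (univ.filter fun i => c i = true).card) :
    (univ.filter fun y : Fin n → hybridAlphabet =>
      ((symbolSet y univ 1).card = ℓ ∧ (symbolSet y univ 0).card = u) ∧
        ∃ c ∈ C, c ≠ (fun _ => false) ∧
          (symbolSet y (univ.filter fun i => c i = true) (-1)).card ≤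
            (symbolSet y (univ.filter fun i => c i = true) 1).card).card ≤
      ∑ w ∈ Icc d n, S w * ∑ ρ ∈ range (min u w + 1),
        ∑ μ ∈ (Icc ((w - ρ + 1) / 2) (min ℓ w)).filter (fun μ => μ + ρ ≤ w),
          trinom w μ ρ * trinom (n - w) (ℓ - μ) (u - ρ) := by
  let B (s : Finset (Fin n)) (ρ μ : ℕ) : Finset (Fin n → hybridAlphabet) :=
    univ.filter fun y => ((symbolSet y s 1).card = μ ∧ (symbolSet y s 0).card = ρ) ∧
      (symbolSet y sᶜ 1).card = ℓ - μ ∧ (symbolSet y sᶜ 0).card = u - ρ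
  let M (w ρ : ℕ) : Finset ℕ := (Icc ((w - ρ + 1) / 2) (min ℓ w)).filter fun μ => μ + ρ ≤ w
  let supp (c : Fin n → Bool) : Finset (Fin n) := univ.filter fun i => c i = true
  let D (w : ℕ) : Finset (Fin n → Bool) := C.filter fun c => (supp c).card = w
  refine (card_le_card (t := (Icc d n).biUnion fun w => (D w).biUnion fun c =>
    (range (min u w + 1)).biUnion fun ρ => (M w ρ).biUnion fun μ => B (supp c) ρ μ) ?_).trans ?_
  · intro y hy
    obtain ⟨-, ⟨hℓ, hu⟩, c, hc, hc₀, hle⟩ := mem_filter.1 hy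
    have hn : (supp c).card ≤ n := by simpa using card_le_univ (supp c)
    have hsum := card_symbolSet_sum y (supp c)
    have h₁ := card_symbolSet_add_compl y (supp c) 1
    have h₀ := card_symbolSet_add_compl y (supp c) 0
    have hdc : d ≤ (supp c).card := hd c hc hc₀
    change (symbolSet y (supp c) (-1)).card ≤ (symbolSet y (supp c) 1).card at hle
    simp only [mem_biUnion, mem_Icc, mem_range, D, M, B, mem_filter, mem_univ, true_and]
    exact ⟨_, ⟨hdc, hn⟩, c, ⟨hc, rfl⟩, _, by omega, _, ⟨by omega, by omega⟩, ⟨rfl, rfl⟩,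
      by omega, by omega⟩
  · refine card_biUnion_le.trans (sum_le_sum fun w _ => ?_)
    rw [hS, ← smul_eq_mul]
    refine card_biUnion_le.trans (sum_le_card_nsmul _ _ _ fun c hc => ?_)
    refine card_biUnion_le.trans (sum_le_sum fun ρ _ => ?_)
    refine card_biUnion_le.trans (sum_le_sum fun μ _ => ?_)
    have := card_filter_symbolSet_split_le (supp c) μ ρ (ℓ - μ) (u - ρ)
    rwa [(mem_filter.1 hc).2, Fintype.card_fin] at this

/-- **Poltyrev-type bound for the hybrid BSC-BEC channel.**
`C` is a binary linear code of length `n` with weight distribution `S` and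
minimum distance `dmin`, used over the hybrid BSC-BEC channel with flip
probability `ε > 0` and erasure probability `δ ≥ 0`, where `2ε + δ < 1`.
With the all-zero codeword transmitted, the maximum-likelihood (worst-case
tie-breaking) decoding error probability `Pe` satisfies the bound of the
lemma: the outer sums range over the number of flips `ℓ` and erasures `u`, the
inner sums over the numbers `ρ` of erasures and `μ` of flips falling on the
support of a weight-`w` codeword, with `μ ≥ ⌈(w-ρ)/2⌉` and `μ + ρ ≤ w`. -/
theorem poltyrev_bound_BSC_BEC
    (n : ℕ) (ε δ : ℝ) (hε : 0 < ε) (hδ : 0 ≤ δ) (hεδ : 2 * ε + δ < 1)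
    (C : Finset (Fin n → Bool))
    (hzero : (fun _ => false) ∈ C)
    (hlin : ∀ c ∈ C, ∀ c' ∈ C, (fun i => Bool.xor (c i) (c' i)) ∈ C)
    (S : ℕ → ℕ)
    (hS : ∀ w, S w =
      (C.filter (fun c => (univ.filter (fun i => c i = true)).card = w)).card)
    (dmin : ℕ)
    (hdmin : IsLeast {w | ∃ c ∈ C, c ≠ (fun _ => false) ∧
      (univ.filter (fun i => c i = true)).card = w} dmin)
    (Pe : ℝ)
    (hPe : Pe = ∑ y : Fin n → hybridAlphabet,
      (∏ i, hybridTrans ε δ (y i : ℤ) false) *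
        (if ∃ c ∈ C, c ≠ (fun _ => false) ∧
            (∏ i, hybridTrans ε δ (y i : ℤ) false) ≤
              ∏ i, hybridTrans ε δ (y i : ℤ) (c i)
         then 1 else 0)) :
    Pe ≤
      ∑ ℓ ∈ Finset.range (n + 1), ∑ u ∈ Finset.range (n - ℓ + 1),
        ε ^ ℓ * δ ^ u * (1 - ε - δ) ^ (n - ℓ - u) *
          min
            (∑ w ∈ Finset.Icc dmin n, (S w : ℝ) *
              ∑ ρ ∈ Finset.range (min u w + 1),
                ∑ μ ∈ (Finset.Icc ((w - ρ + 1) / 2) (min ℓ w)).filter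
                    (fun μ => μ + ρ ≤ w),
                  ((trinom w μ ρ : ℕ) : ℝ) *
                    ((trinom (n - w) (ℓ - μ) (u - ρ) : ℕ) : ℝ))
            ((trinom n ℓ u : ℕ) : ℝ) := by
  subst hPe
  have hsum (y : Fin n → hybridAlphabet) := card_symbolSet_sum y univ
  simp only [card_univ, Fintype.card_fin] at hsum
  have hp : 0 < 1 - ε - δ := by linarith
  rw [← sum_fiberwise_of_maps_to (t := range (n + 1))
    (g := fun y : Fin n → hybridAlphabet => (symbolSet y univ 1).card)
    (fun y _ => mem_range.2 (by have := hsum y; omega))]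
  refine sum_le_sum fun ℓ _ => ?_
  rw [← sum_fiberwise_of_maps_to (t := range (n - ℓ + 1))
    (g := fun y : Fin n → hybridAlphabet => (symbolSet y univ 0).card)
    (fun y hy => mem_range.2 (by have := hsum y; have := (mem_filter.1 hy).2; omega))]
  refine sum_le_sum fun u _ => ?_
  rw [filter_filter]
  have hweight (y : Fin n → hybridAlphabet)
      (hy : (symbolSet y univ 1).card = ℓ ∧ (symbolSet y univ 0).card = u) :
      ∏ i, hybridTrans ε δ (y i) false = ε ^ ℓ * δ ^ u * (1 - ε - δ) ^ (n - ℓ - u) := by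
    have hcorrect : (symbolSet y univ (-1)).card = n - ℓ - u := by have := hsum y; omega
    rw [prod_hybridTrans_false, hy.1, hy.2, hcorrect]
  rw [sum_congr rfl fun y hy => by rw [hweight y (mem_filter.1 hy).2], ← mul_sum]
  by_cases hzero' : ε ^ ℓ * δ ^ u * (1 - ε - δ) ^ (n - ℓ - u) = 0
  · simp [hzero']
  refine mul_le_mul_of_nonneg_left ?_ (by positivity)
  rw [sum_boole, filter_filter]
  refine le_min ?_ ?_
  · refine le_trans (Nat.cast_le.2 (card_le_card fun y hy => ?_))
      ((Nat.cast_le (α := ℝ).2 (card_dominated_le C S hS dmin ℓ u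
        fun c hc hc₀ => hdmin.2 ⟨c, hc, hc₀, rfl⟩)).trans_eq (by push_cast; rfl))
    obtain ⟨-, hy, c, hc, hc₀, hle⟩ := mem_filter.1 hy
    rw [← hweight y hy] at hle hzero'
    exact mem_filter.2 ⟨mem_univ y, hy, c, hc, hc₀,
      card_correct_le_card_flips hε hδ hεδ hzero' hle⟩
  · have hcard := card_filter_symbolSet_le (ι := Fin n) ℓ u
    rw [Fintype.card_fin] at hcard
    refine Nat.cast_le.2 (le_trans (card_le_card fun y hy => ?_) hcard)
    exact mem_filter.2 ⟨mem_univ y, (mem_filter.1 hy).2.1⟩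

end
end

section
/- For transmission of a binary linear code over a binary memoryless symmetric channel, and for any vector m = (m_{−M+1},…,m_M) of nonnegative integers, the maximum-likelihood decoding error probability satisfies P_e ≤ Σ_{ℓ ∈ Ũ_n(m)} (∏_{j=−M}^{M} ε_{j|0}^{ℓ_j}) · min{ Σ_{w=d_min}^{n} S_w Σ_{μ} (w choose μ_{−M},…,μ_M)(n−w choose ℓ_{−M}−μ_{−M},…,ℓ_M−μ_M), (n choose ℓ_{−M},…,ℓ_M) } + Σ_{ℓ ∉ Ũ_n(m), Σ_j ℓ_j = n} (∏_{j=−M}^{M} ε_{j|0}^{ℓ_j}) (n choose ℓ_{−M},…,ℓ_M), where Ũ_n(m) = { ℓ ∈ Z_{≥0}^{2M+1} : Σ_j ℓ_j = n and ℓ_j ≤ m_j for all j = −M+1,…,M }, and the inner sum over μ ranges over all vectors μ of nonnegative integers with Σ_j μ_j = w, μ_j ≤ ℓ_j for every j, and ∏_j ε_{j|0}^{μ_j} ≤ ∏_j ε_{j|1}^{μ_j}. -/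
/-!
The computationally simplified (rectangular-type-search) version of the
extended Poltyrev bound for BMS channels.
-/

open Finset

open scoped Classical

noncomputable section

/-- The number of words `y : ι → α` in which each symbol `j` occurs exactly `ℓ j` times is the
multinomial coefficient of `ℓ`. -/
lemma card_filter_forall_card_fiber_eq {ι α : Type*} [Fintype ι] [DecidableEq ι] [Fintype α]
    [DecidableEq α] (ℓ : α → ℕ)
    (hℓ : ∑ j, ℓ j = Fintype.card ι) :
    #{y : ι → α | ∀ j, #{i | y i = j} = ℓ j} = Nat.multinomial univ ℓ := by
  let d : α →₀ ℕ := Finsupp.equivFunOnFinite.symm ℓ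
  have h := MvPolynomial.coeff_sum_X_pow_of_fintype (R := ℕ) d (Fintype.card ι)
  have hd : d.sum (fun _ m ↦ m) = Fintype.card ι := by
    rw [Finsupp.sum_fintype _ _ fun _ ↦ rfl, ← hℓ]
    rfl
  rw [if_pos hd, Finsupp.multinomial_eq_of_support_subset (subset_univ d.support)] at h
  have hprod : ∀ y : ι → α, ∏ i, (MvPolynomial.X (y i) : MvPolynomial α ℕ) =
      MvPolynomial.monomial (∑ i, Finsupp.single (y i) 1) 1 := fun y ↦ by
    rw [MvPolynomial.monomial_sum_one]
    rfl
  have hcoeff : ∀ y : ι → α, (∑ i, Finsupp.single (y i) 1 = d) ↔ ∀ j, #{i | y i = j} = ℓ j := by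
    intro y
    rw [DFunLike.ext_iff]
    refine forall_congr' fun j ↦ ?_
    rw [Finsupp.finsetSum_apply, card_filter]
    simp only [Finsupp.single_apply]
    rfl
  rw [← card_univ (α := ι), ← prod_const, prod_univ_sum, Fintype.piFinset_univ,
    MvPolynomial.coeff_sum] at h
  simp only [hprod, MvPolynomial.coeff_monomial, hcoeff] at h
  rw [← card_filter] at h
  exact h

/-- The number of words of type `ℓ` whose restriction to `T` has type `μ` is at most the product
of the number of words of type `μ` on `T` and of type `ℓ - μ` on the complement of `T`. -/
lemma card_filter_card_fiber_eq_and_card_fiber_inter_eq_le {ι α : Type*} [Fintype ι]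
    [DecidableEq ι] [Fintype α] [DecidableEq α]
    (T : Finset ι) (ℓ μ : α → ℕ) (hℓ : ∑ j, ℓ j = Fintype.card ι) (hμ : ∑ j, μ j = #T)
    (hle : ∀ j, μ j ≤ ℓ j) :
    #{y : ι → α | (∀ j, #{i | y i = j} = ℓ j) ∧ ∀ j, #{i ∈ T | y i = j} = μ j} ≤
      Nat.multinomial univ μ * Nat.multinomial univ (fun j ↦ ℓ j - μ j) := by
  have hcompl : ∑ j, (ℓ j - μ j) = Fintype.card ↥(Tᶜ) := by
    rw [sum_tsub_distrib _ fun j _ ↦ hle j, hℓ, hμ, Fintype.card_coe, card_compl]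
  have hcard : ∀ (U : Finset ι) (y : ι → α) (j : α),
      #{i : U | y i = j} = #{i ∈ U | y i = j} := fun U y j ↦ by
    rw [← card_map (Function.Embedding.subtype (· ∈ U))]
    congr 1
    ext i
    simp [and_comm]
  rw [← card_filter_forall_card_fiber_eq (ι := T) μ (by rw [hμ, Fintype.card_coe]),
    ← card_filter_forall_card_fiber_eq (ι := ↥(Tᶜ)) _ hcompl, ← card_product]
  refine card_le_card_of_injOn (fun y ↦ (fun i ↦ y i, fun i ↦ y i)) ?_ ?_
  · intro y hy
    simp only [coe_filter, mem_univ, true_and, Set.mem_ofPred_eq] at hy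
    simp only [coe_product, Set.mem_prod, mem_coe, mem_filter, mem_univ, true_and, hcard]
    refine ⟨hy.2, fun j ↦ ?_⟩
    rw [← hy.1 j, ← hy.2 j, eq_tsub_iff_add_eq_of_le
      (card_le_card (filter_subset_filter _ (subset_univ T))), add_comm,
      ← card_union_of_disjoint (disjoint_filter_filter disjoint_compl_right), ← filter_union,
      union_compl]
  · intro y _ z _ h
    rw [Prod.mk.injEq] at h
    funext i
    by_cases hi : i ∈ T
    · exact congrFun h.1 ⟨i, hi⟩
    · exact congrFun h.2 ⟨i, mem_compl.2 hi⟩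

/-- If `∏ a ≤ ∏ (a or b)`, where `b` is used exactly where `c` is true, and `∏ a > 0`, then the inequality
already holds between the products over that set. -/
lemma prod_filter_le_of_prod_le_prod_ite {ι : Type*} [Fintype ι] (a b : ι → ℝ)
    (ha : ∀ i, 0 ≤ a i) (hpos : ∏ i, a i ≠ 0) (c : ι → Bool)
    (h : ∏ i, a i ≤ ∏ i, if c i = true then b i else a i) :
    ∏ i with c i = true, a i ≤ ∏ i with c i = true, b i := by
  rw [prod_ite, ← prod_filter_mul_prod_filter_not univ (fun i ↦ c i = true) a] at h
  refine le_of_mul_le_mul_right h (lt_of_le_of_ne (prod_nonneg fun i _ ↦ ha i) (Ne.symm ?_))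
  exact prod_ne_zero_iff.2 fun i _ ↦ prod_ne_zero_iff.1 hpos i (mem_univ i)

/-- A product over the symbols of a word depends only on its type. -/
lemma prod_eq_prod_pow_card_fiber {ι α : Type*} [Fintype α] [DecidableEq α]
    (T : Finset ι) (y : ι → α) (f : α → ℝ) : ∏ i ∈ T, f (y i) = ∏ j, f j ^ #{i ∈ T | y i = j} := by
  rw [← prod_fiberwise' T y f]
  simp only [prod_const]

/-- Union bound for the number of words of type `ℓ` on which maximum-likelihood decoding fails. -/
lemma card_type_error_le {α : Type*} [Fintype α] [DecidableEq α] {n : ℕ} (ε : α → Bool → ℝ)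
    (hnn : ∀ j x, 0 ≤ ε j x) (C : Finset (Fin n → Bool)) (dmin : ℕ)
    (hdmin : ∀ c ∈ C, c ≠ (fun _ ↦ false) → dmin ≤ #{i | c i = true})
    (ℓ : α → Fin (n + 1)) (hℓ : ∑ j, (ℓ j : ℕ) = n)
    (hpos : ∏ j, ε j false ^ (ℓ j : ℕ) ≠ 0)
    (F : ℕ → Finset (α → Fin (n + 1)))
    (hF : ∀ w μ, μ ∈ F w ↔ ∑ j, (μ j : ℕ) = w ∧ (∀ j, (μ j : ℕ) ≤ (ℓ j : ℕ)) ∧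
      ∏ j, ε j false ^ (μ j : ℕ) ≤ ∏ j, ε j true ^ (μ j : ℕ))
    (W : Finset (Fin n → α))
    (hW : ∀ y ∈ W, (∀ j, #{i | y i = j} = (ℓ j : ℕ)) ∧
      ∃ c ∈ C, c ≠ (fun _ ↦ false) ∧ ∏ i, ε (y i) false ≤ ∏ i, ε (y i) (c i)) :
    #W ≤ ∑ w ∈ Icc dmin n, #{c ∈ C | #{i | c i = true} = w} *
      ∑ μ ∈ F w, Nat.multinomial univ (fun j ↦ (μ j : ℕ)) *
        Nat.multinomial univ (fun j ↦ (ℓ j : ℕ) - (μ j : ℕ)) := by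
  let G : ℕ → ℕ := fun w ↦ ∑ μ ∈ F w, Nat.multinomial univ (fun j ↦ (μ j : ℕ)) *
    Nat.multinomial univ (fun j ↦ (ℓ j : ℕ) - (μ j : ℕ))
  let wt : (Fin n → Bool) → ℕ := fun c ↦ #{i | c i = true}
  let C' : Finset (Fin n → Bool) := {c ∈ C | c ≠ fun _ ↦ false}
  let B : (Fin n → Bool) → (α → Fin (n + 1)) → Finset (Fin n → α) := fun c μ ↦
    {y | (∀ j, #{i | y i = j} = (ℓ j : ℕ)) ∧
      ∀ j, #{i ∈ ({i | c i = true} : Finset (Fin n)) | y i = j} = (μ j : ℕ)}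
  have hwt : ∀ c, wt c ≤ n := fun c ↦ (card_le_univ _).trans_eq (Fintype.card_fin n)
  have hB : ∀ c, #((F (wt c)).biUnion (B c)) ≤ G (wt c) := fun c ↦ by
    refine card_biUnion_le.trans (sum_le_sum fun μ hμ ↦ ?_)
    rw [hF] at hμ
    exact card_filter_card_fiber_eq_and_card_fiber_inter_eq_le _ _ _
      (hℓ.trans (Fintype.card_fin n).symm) hμ.1 hμ.2.1
  have hsub : W ⊆ C'.biUnion fun c ↦ (F (wt c)).biUnion (B c) := by
    intro y hyW
    obtain ⟨hy, c, hc, hc0, herr⟩ := hW y hyW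
    have hcnt : ∀ j, #{i ∈ ({i | c i = true} : Finset (Fin n)) | y i = j} ≤ (ℓ j : ℕ) :=
      fun j ↦ (card_le_card (filter_subset_filter _ (subset_univ _))).trans_eq (hy j)
    have hle : ∏ i with c i = true, ε (y i) false ≤ ∏ i with c i = true, ε (y i) true := by
      refine prod_filter_le_of_prod_le_prod_ite _ _ (fun i ↦ hnn _ _) ?_ c (herr.trans_eq ?_)
      · rw [prod_eq_prod_pow_card_fiber univ y fun j ↦ ε j false]
        simpa only [hy] using hpos
      · refine prod_congr rfl fun i _ ↦ ?_
        cases c i <;> simp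
    rw [prod_eq_prod_pow_card_fiber _ y fun j ↦ ε j false,
      prod_eq_prod_pow_card_fiber _ y fun j ↦ ε j true] at hle
    refine mem_biUnion.2 ⟨c, mem_filter.2 ⟨hc, hc0⟩, mem_biUnion.2
      ⟨fun j ↦ ⟨_, (hcnt j).trans_lt (ℓ j).isLt⟩, (hF _ _).2 ⟨?_, hcnt, hle⟩,
        mem_filter.2 ⟨mem_univ _, hy, fun _ ↦ rfl⟩⟩⟩
    exact (card_eq_sum_card_fiberwise (s := {i | c i = true}) (f := y)
      fun i _ ↦ mem_coe.2 (mem_univ (y i))).symm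
  calc _ ≤ ∑ c ∈ C', G (wt c) :=
        (card_le_card hsub).trans (card_biUnion_le.trans (sum_le_sum fun c _ ↦ hB c))
    _ = ∑ w ∈ Icc dmin n, ∑ c ∈ C' with wt c = w, G w := by
        refine (sum_fiberwise_of_maps_to' (fun c hc ↦ ?_) G).symm
        obtain ⟨hc, hc0⟩ := mem_filter.1 hc
        exact mem_Icc.2 ⟨hdmin c hc hc0, hwt c⟩
    _ ≤ ∑ w ∈ Icc dmin n, #{c ∈ C | wt c = w} * G w := by
        refine sum_le_sum fun w _ ↦ ?_
        rw [sum_const, smul_eq_mul]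
        exact Nat.mul_le_mul_right _
          (card_le_card (filter_subset_filter _ (filter_subset _ _)))

/-- **Rectangular-type-search Poltyrev bound for a BMS channel.**
The setting is as in the extended Poltyrev bound: BMS channel with output
alphabet `{-M, …, M}`, transition probabilities `ε`, and a binary linear code
`C` with weight distribution `S` and minimum distance `dmin`; the all-zero
codeword is transmitted and `Pe` is the ML (worst-case tie-breaking) error
probability.  For any vector `m = (m_{-M+1}, …, m_M)` of nonnegative integers,
the type search may be restricted to the "rectangular" set
`Ũ_n(m) = {ℓ : Σ_j ℓ_j = n, ℓ_j ≤ m_j for all j ≠ -M}`, with all remaining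
types contributing via the trivial bound (their total probability). -/
theorem poltyrev_bound_BMS_rect
    (M n : ℕ) (ε : ℤ → Bool → ℝ)
    (hnn : ∀ y x, 0 ≤ ε y x)
    (hsum : ∀ x, ∑ y ∈ Finset.Icc (-(M : ℤ)) (M : ℤ), ε y x = 1)
    (hsym : ∀ y ∈ Finset.Icc (-(M : ℤ)) (M : ℤ), ε y true = ε (-y) false)
    (C : Finset (Fin n → Bool))
    (hzero : (fun _ => false) ∈ C)
    (hlin : ∀ c ∈ C, ∀ c' ∈ C, (fun i => Bool.xor (c i) (c' i)) ∈ C)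
    (S : ℕ → ℕ)
    (hS : ∀ w, S w =
      (C.filter (fun c => (univ.filter (fun i => c i = true)).card = w)).card)
    (dmin : ℕ)
    (hdmin : IsLeast {w | ∃ c ∈ C, c ≠ (fun _ => false) ∧
      (univ.filter (fun i => c i = true)).card = w} dmin)
    (m : ℤ → ℕ)
    (Pe : ℝ)
    (hPe : Pe = ∑ y : Fin n → outAlphabet M,
      (∏ i, ε (y i : ℤ) false) *
        (if ∃ c ∈ C, c ≠ (fun _ => false) ∧
            (∏ i, ε (y i : ℤ) false) ≤ ∏ i, ε (y i : ℤ) (c i)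
         then 1 else 0)) :
    Pe ≤
      (∑ ℓ ∈ (univ : Finset (outAlphabet M → Fin (n + 1))).filter
          (fun ℓ => ∑ j, (ℓ j : ℕ) = n ∧
            ∀ j : outAlphabet M, (j : ℤ) ≠ -(M : ℤ) → (ℓ j : ℕ) ≤ m (j : ℤ)),
        (∏ j : outAlphabet M, ε (j : ℤ) false ^ (ℓ j : ℕ)) *
          min
            (∑ w ∈ Finset.Icc dmin n, (S w : ℝ) *
              ∑ μ ∈ (univ : Finset (outAlphabet M → Fin (n + 1))).filter
                  (fun μ => (∑ j, (μ j : ℕ) = w) ∧ (∀ j, (μ j : ℕ) ≤ (ℓ j : ℕ)) ∧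
                    (∏ j : outAlphabet M, ε (j : ℤ) false ^ (μ j : ℕ)) ≤
                      ∏ j : outAlphabet M, ε (j : ℤ) true ^ (μ j : ℕ)),
                ((Nat.multinomial univ (fun j => (μ j : ℕ))) : ℝ) *
                  ((Nat.multinomial univ (fun j => (ℓ j : ℕ) - (μ j : ℕ))) : ℝ))
            ((Nat.multinomial univ (fun j => (ℓ j : ℕ))) : ℝ)) +
      ∑ ℓ ∈ (univ : Finset (outAlphabet M → Fin (n + 1))).filter
          (fun ℓ => ∑ j, (ℓ j : ℕ) = n ∧
            ¬ (∀ j : outAlphabet M, (j : ℤ) ≠ -(M : ℤ) → (ℓ j : ℕ) ≤ m (j : ℤ))),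
        (∏ j : outAlphabet M, ε (j : ℤ) false ^ (ℓ j : ℕ)) *
          ((Nat.multinomial univ (fun j => (ℓ j : ℕ))) : ℝ) := by
  subst hPe
  have hℓcard : ∀ ℓ : outAlphabet M → Fin (n + 1), ∑ j, (ℓ j : ℕ) = n →
      ∑ j, (ℓ j : ℕ) = Fintype.card (Fin n) := fun ℓ h ↦ h.trans (Fintype.card_fin n).symm
  obtain ⟨E, hE⟩ : ∃ E : (Fin n → outAlphabet M) → Prop, ∀ y, (∃ c ∈ C, c ≠ (fun _ => false) ∧
    (∏ i, ε (y i : ℤ) false) ≤ ∏ i, ε (y i : ℤ) (c i)) ↔ E y := ⟨_, fun _ ↦ Iff.rfl⟩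
  simp only [hE]
  let p : (outAlphabet M → Fin (n + 1)) → ℝ := fun ℓ ↦
    ∏ j : outAlphabet M, ε (j : ℤ) false ^ (ℓ j : ℕ)
  have hp : ∀ ℓ, 0 ≤ p ℓ := fun ℓ ↦ prod_nonneg fun j _ ↦ pow_nonneg (hnn _ _) _
  let type : (Fin n → outAlphabet M) → outAlphabet M → Fin (n + 1) := fun y j ↦
    ⟨#{i | y i = j}, Nat.lt_succ_of_le ((card_le_univ _).trans_eq (Fintype.card_fin n))⟩
  have htype : ∀ y ℓ, type y = ℓ ↔ ∀ j, #{i | y i = j} = (ℓ j : ℕ) := fun y ℓ ↦ by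
    simp only [funext_iff, Fin.ext_iff, type]
  have hmaps : ∀ y ∈ (univ : Finset (Fin n → outAlphabet M)), type y ∈
      ({ℓ | ∑ j, (ℓ j : ℕ) = n} : Finset (outAlphabet M → Fin (n + 1))) := fun y _ ↦ by
    refine mem_filter.2 ⟨mem_univ _, ?_⟩
    exact (card_eq_sum_card_fiberwise fun _ _ ↦ mem_coe.2 (mem_univ _)).symm.trans
      (card_fin n)
  have hfiber : ∀ ℓ, (∑ y with type y = ℓ,
      (∏ i, ε (y i : ℤ) false) * (if E y then (1 : ℝ) else 0)) =
        p ℓ * #{y | (∀ j, #{i | y i = j} = (ℓ j : ℕ)) ∧ E y} := fun ℓ ↦ by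
    simp only [htype]
    rw [← filter_filter, natCast_card_filter, mul_sum]
    refine sum_congr rfl fun y hy ↦ ?_
    rw [prod_eq_prod_pow_card_fiber univ y fun j : outAlphabet M ↦ ε (j : ℤ) false]
    simp only [(mem_filter.1 hy).2, p]
  have htrivial : ∀ ℓ : outAlphabet M → Fin (n + 1), ∑ j, (ℓ j : ℕ) = n →
      #{y : Fin n → outAlphabet M | (∀ j, #{i | y i = j} = (ℓ j : ℕ)) ∧ E y} ≤
        Nat.multinomial univ (fun j ↦ (ℓ j : ℕ)) := fun ℓ hℓ ↦ by
    rw [← card_filter_forall_card_fiber_eq _ (hℓcard ℓ hℓ), ← filter_filter]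
    exact card_filter_le _ _
  rw [← sum_fiberwise_of_maps_to hmaps, ← sum_filter_add_sum_filter_not _
    (fun ℓ ↦ ∀ j : outAlphabet M, (j : ℤ) ≠ -(M : ℤ) → (ℓ j : ℕ) ≤ m (j : ℤ)),
    filter_filter, filter_filter]
  refine add_le_add (sum_le_sum fun ℓ hℓ ↦ ?_) (sum_le_sum fun ℓ hℓ ↦ ?_)
  · have hn := (mem_filter.1 hℓ).2.1
    refine (hfiber ℓ).trans_le ?_
    by_cases h0 : p ℓ = 0
    · rw [h0, zero_mul]
      exact (mul_eq_zero_of_left h0 _).ge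
    · refine mul_le_mul_of_nonneg_left (le_min ?_ (by exact_mod_cast htrivial ℓ hn)) (hp ℓ)
      have h := card_type_error_le (fun (j : outAlphabet M) x ↦ ε (j : ℤ) x)
        (fun _ _ ↦ hnn _ _) C dmin (fun c hc hc0 ↦ hdmin.2 ⟨c, hc, hc0, rfl⟩) ℓ hn h0 _
        (fun w μ ↦ mem_filter_univ μ)
        {y | (∀ j, #{i | y i = j} = (ℓ j : ℕ)) ∧ E y}
        (fun y hy ↦ ⟨((mem_filter_univ y).1 hy).1, (hE y).2 ((mem_filter_univ y).1 hy).2⟩)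
      simp only [← hS] at h
      exact_mod_cast h
  · refine (hfiber ℓ).trans_le (mul_le_mul_of_nonneg_left ?_ (hp ℓ))
    exact_mod_cast htrivial ℓ (mem_filter.1 hℓ).2.1

end
end
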